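/- arXiv:2511.10201 — 5 statements merged into one kernel-verified Lean document; each statement's English description precedes it below -/
import Mathlib

section
/- Let a, b > 0, w ∈ (0,1), and define the weighted power mean M_ρ(a,b) = (w·a^ρ + (1−w)·b^ρ)^(1/ρ) for ρ ≠ 0, with M_0(a,b) = a^w · b^(1−w) (the continuous extension). Set Δ = |log(a/b)|. Then for all ρ₁, ρ₂ ∈ ℝ, |log M_{ρ₁}(a,b) − log M_{ρ₂}(a,b)| ≤ (Δ²/8)·|ρ₁ − ρ₂|. In particular, the bound is independent of w. -/
/-- The weighted power mean `M_ρ(a,b) = (w·a^ρ + (1−w)·b^ρ)^(1/ρ)` for `ρ ≠ 0`,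
extended by continuity to `M_0(a,b) = a^w · b^(1−w)`. -/
noncomputable def powerMean (w a b ρ : ℝ) : ℝ :=
  if ρ = 0 then a ^ w * b ^ (1 - w)
  else (w * a ^ ρ + (1 - w) * b ^ ρ) ^ (1 / ρ)

/-- The partition function `w e^{tα} + (1-w) e^{tβ}`. -/
noncomputable def pmZ (w α β t : ℝ) : ℝ := w * Real.exp (t * α) + (1 - w) * Real.exp (t * β)

/-- The derivative of `log pmZ`. -/
noncomputable def pmD (w α β t : ℝ) : ℝ :=
  (w * (Real.exp (t * α) * α) + (1 - w) * (Real.exp (t * β) * β)) / pmZ w α β t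

lemma pmZ_pos {w : ℝ} (hw : w ∈ Set.Ioo (0 : ℝ) 1) (α β t : ℝ) : 0 < pmZ w α β t := by
  have h1 := hw.1
  have h2 : 0 < 1 - w := by linarith [hw.2]
  unfold pmZ; positivity

lemma hasDerivAt_expmul (α t : ℝ) :
    HasDerivAt (fun t : ℝ => Real.exp (t * α)) (Real.exp (t * α) * α) t := by
  have h : HasDerivAt (fun t : ℝ => t * α) α t := by
    simpa using (hasDerivAt_id t).mul_const α
  exact h.exp

lemma hasDerivAt_pmZ (w α β t : ℝ) : HasDerivAt (pmZ w α β)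
    (w * (Real.exp (t * α) * α) + (1 - w) * (Real.exp (t * β) * β)) t :=
  ((hasDerivAt_expmul α t).const_mul w).add ((hasDerivAt_expmul β t).const_mul (1 - w))

lemma hasDerivAt_logZ {w : ℝ} (hw : w ∈ Set.Ioo (0 : ℝ) 1) (α β t : ℝ) :
    HasDerivAt (fun t => Real.log (pmZ w α β t)) (pmD w α β t) t :=
  (hasDerivAt_pmZ w α β t).log (pmZ_pos hw α β t).ne'

lemma hasDerivAt_pmD {w : ℝ} (hw : w ∈ Set.Ioo (0 : ℝ) 1) (α β t : ℝ) :
    HasDerivAt (pmD w α β) ((w * Real.exp (t * α)) * ((1 - w) * Real.exp (t * β)) * (α - β) ^ 2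
      / pmZ w α β t ^ 2) t := by
  have hn : HasDerivAt
      (fun t : ℝ => w * (Real.exp (t * α) * α) + (1 - w) * (Real.exp (t * β) * β))
      (w * (Real.exp (t * α) * α * α) + (1 - w) * (Real.exp (t * β) * β * β)) t :=
    (((hasDerivAt_expmul α t).mul_const α).const_mul w).add
      (((hasDerivAt_expmul β t).mul_const β).const_mul (1 - w))
  have h := hn.div (hasDerivAt_pmZ w α β t) (pmZ_pos hw α β t).ne'
  refine h.congr_deriv ?_
  congr 1
  unfold pmZ
  ring

lemma pmD_lip {w : ℝ} (hw : w ∈ Set.Ioo (0 : ℝ) 1) (α β x y : ℝ) :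
    |pmD w α β x - pmD w α β y| ≤ (α - β) ^ 2 / 4 * |x - y| := by
  have := Convex.norm_image_sub_le_of_norm_hasDerivWithin_le (s := Set.univ)
    (f := pmD w α β) (C := (α - β) ^ 2 / 4)
    (fun t _ => (hasDerivAt_pmD hw α β t).hasDerivWithinAt) (fun t _ => ?_) convex_univ
    (Set.mem_univ y) (Set.mem_univ x)
  · simpa [Real.norm_eq_abs] using this
  · have hZ := pmZ_pos hw α β t
    have h1 := hw.1
    have h2 : 0 < 1 - w := by linarith [hw.2]
    rw [Real.norm_eq_abs, abs_of_nonneg (by positivity), div_le_iff₀ (by positivity)]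
    unfold pmZ
    generalize w * Real.exp (t * α) = p
    generalize (1 - w) * Real.exp (t * β) = q
    nlinarith [mul_nonneg (sq_nonneg (p - q)) (sq_nonneg (α - β))]

lemma pmD_cont {w : ℝ} (hw : w ∈ Set.Ioo (0 : ℝ) 1) (α β : ℝ) : Continuous (pmD w α β) :=
  continuous_iff_continuousAt.2 fun t => (hasDerivAt_pmD hw α β t).continuousAt

lemma log_powerMean_eq {a b w : ℝ} (ha : 0 < a) (hb : 0 < b) (hw : w ∈ Set.Ioo (0 : ℝ) 1)
    (ρ : ℝ) : Real.log (powerMean w a b ρ) =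
      ∫ s in (0 : ℝ)..1, pmD w (Real.log a) (Real.log b) (ρ * s) := by
  unfold powerMean
  split_ifs with h
  · subst h
    rw [Real.log_mul (by positivity) (by positivity), Real.log_rpow ha, Real.log_rpow hb]
    simp [pmD, pmZ]
  · have hZ : w * a ^ ρ + (1 - w) * b ^ ρ = pmZ w (Real.log a) (Real.log b) ρ := by
      rw [pmZ, Real.rpow_def_of_pos ha, Real.rpow_def_of_pos hb, mul_comm ρ, mul_comm ρ]
    rw [hZ, Real.log_rpow (pmZ_pos hw _ _ _), intervalIntegral.integral_comp_mul_left _ h,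
      intervalIntegral.integral_eq_sub_of_hasDerivAt
        (fun t _ => hasDerivAt_logZ hw _ _ t) ((pmD_cont hw _ _).intervalIntegrable _ _)]
    simp [pmZ]

/-- Global sensitivity of the weighted power mean to the exponent:
`|log M_{ρ₁}(a,b) − log M_{ρ₂}(a,b)| ≤ (Δ²/8)·|ρ₁ − ρ₂|` with `Δ = |log(a/b)|`,
independently of `w`. -/
theorem log_powerMean_lipschitz_in_exponent
    (a b w : ℝ) (ha : 0 < a) (hb : 0 < b) (hw : w ∈ Set.Ioo (0 : ℝ) 1)
    (Δ : ℝ) (hΔ : Δ = |Real.log (a / b)|) :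
    ∀ ρ₁ ρ₂ : ℝ,
      |Real.log (powerMean w a b ρ₁) - Real.log (powerMean w a b ρ₂)| ≤
        Δ ^ 2 / 8 * |ρ₁ - ρ₂| := by
  intro ρ₁ ρ₂
  rw [hΔ, sq_abs, Real.log_div ha.ne' hb.ne', log_powerMean_eq ha hb hw, log_powerMean_eq ha hb hw]
  set α := Real.log a
  set β := Real.log b
  have hc := pmD_cont hw α β
  have hi : ∀ ρ : ℝ, IntervalIntegrable (fun s => pmD w α β (ρ * s)) MeasureTheory.volume 0 1 :=
    fun ρ => (hc.comp (by fun_prop : Continuous fun s : ℝ => ρ * s)).intervalIntegrable _ _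
  rw [← intervalIntegral.integral_sub (hi _) (hi _)]
  have key := intervalIntegral.norm_integral_le_of_norm_le (μ := MeasureTheory.volume)
    (a := (0 : ℝ)) (b := 1)
    (f := fun s => pmD w α β (ρ₁ * s) - pmD w α β (ρ₂ * s))
    (g := fun s => (α - β) ^ 2 / 4 * |ρ₁ - ρ₂| * s) zero_le_one
    (Filter.Eventually.of_forall fun s hs => by
      have := pmD_lip hw α β (ρ₁ * s) (ρ₂ * s)
      rw [← sub_mul, abs_mul, abs_of_pos hs.1] at this
      rw [Real.norm_eq_abs]
      linarith)
    ((by fun_prop : Continuous fun s : ℝ => (α - β) ^ 2 / 4 * |ρ₁ - ρ₂| * s).intervalIntegrable _ _)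
  rw [Real.norm_eq_abs, intervalIntegral.integral_const_mul, integral_id] at key
  linarith
end

section
/- Let a, b > 0, w ∈ (0,1), M_ρ(a,b) = (w·a^ρ + (1−w)·b^ρ)^(1/ρ) for ρ ≠ 0 with M_0(a,b) = a^w · b^(1−w), and Δ = |log(a/b)|. Then for all ρ₁, ρ₂ ∈ ℝ, exp(−(Δ²/8)·|ρ₁ − ρ₂|) ≤ M_{ρ₁}(a,b)/M_{ρ₂}(a,b) ≤ exp((Δ²/8)·|ρ₁ − ρ₂|). -/
/-- The slope from the origin (extended by the derivative at `0`) of a convex function is monotone. -/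
theorem pm_slope_mono (f df ddf : ℝ → ℝ) (h1 : ∀ r, HasDerivAt f (df r) r)
    (h2 : ∀ r, HasDerivAt df (ddf r) r) (h3 : ∀ r, 0 ≤ ddf r) (h0 : f 0 = 0) (r s : ℝ)
    (hrs : r ≤ s) :
    (if r = 0 then df 0 else f r / r) ≤ (if s = 0 then df 0 else f s / s) := by
  have hd : deriv f = df := funext fun r => (h1 r).deriv
  have hd2 : deriv df = ddf := funext fun r => (h2 r).deriv
  have hc : ConvexOn ℝ Set.univ f := by
    apply convexOn_univ_of_deriv2_nonneg
    · exact fun r => (h1 r).differentiableAt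
    · rw [hd]; exact fun r => (h2 r).differentiableAt
    · intro x
      simp only [Function.iterate_succ, Function.iterate_zero, Function.comp, id, hd, hd2]
      exact h3 x
  have ht : ∀ z, df 0 * z ≤ f z := by
    intro z
    rcases lt_trichotomy z 0 with hz | hz | hz
    · have := hc.slope_le_of_hasDerivAt (Set.mem_univ z) (Set.mem_univ 0) hz (h1 0)
      rw [slope_def_field, h0, div_le_iff₀ (by linarith)] at this
      linarith
    · simp [hz, h0]
    · have := hc.le_slope_of_hasDerivAt (Set.mem_univ 0) (Set.mem_univ z) hz (h1 0)
      rw [slope_def_field, h0, le_div_iff₀ (by linarith)] at this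
      linarith
  split_ifs with hr hs hs
  · exact le_rfl
  · have : 0 < s := lt_of_le_of_ne (hr ▸ hrs) (Ne.symm hs)
    rw [le_div_iff₀ this]; exact ht s
  · have : r < 0 := lt_of_le_of_ne (hs ▸ hrs) hr
    rw [div_le_iff_of_neg this]; exact ht r
  · have := hc.secant_mono (Set.mem_univ 0) (Set.mem_univ r) (Set.mem_univ s) hr hs hrs
    simpa [h0] using this

theorem pm_log_bounds (a b w : ℝ) (ha : 0 < a) (hb : 0 < b) (hw : w ∈ Set.Ioo (0 : ℝ) 1) :
    ∃ L : ℝ → ℝ, (∀ r, powerMean w a b r = Real.exp (L r)) ∧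
      ∀ r s, r ≤ s → L r ≤ L s ∧ L s - L r ≤ (Real.log (a / b)) ^ 2 / 8 * (s - r) := by
  obtain ⟨hw0, hw1⟩ := hw
  set t := Real.log (a / b) with ht
  set y := Real.log b with hy
  have hx : Real.log a = t + y := by rw [ht, Real.log_div ha.ne' hb.ne']; ring
  let u : ℝ → ℝ := fun r => w * Real.exp (r * t)
  have hu : ∀ r, 0 < u r := fun r => by positivity
  have hD : ∀ r, 0 < u r + (1 - w) := fun r => by linarith [hu r]
  have du : ∀ r, HasDerivAt u (t * u r) r := by
    intro r
    have := (((hasDerivAt_id r).mul_const t).exp).const_mul w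
    refine HasDerivAt.congr_deriv this ?_
    simp [u]; ring
  let K : ℝ → ℝ := fun r => r * y + Real.log (u r + (1 - w))
  let derK : ℝ → ℝ := fun r => y + t * u r / (u r + (1 - w))
  let ddK : ℝ → ℝ := fun r => t ^ 2 * (u r * (1 - w) / (u r + (1 - w)) ^ 2)
  have dK : ∀ r, HasDerivAt K (derK r) r := by
    intro r
    have := ((hasDerivAt_id r).mul_const y).add (((du r).add_const (1 - w)).log (hD r).ne')
    refine HasDerivAt.congr_deriv this ?_
    simp [derK]
  have hddK : ∀ r, HasDerivAt derK (ddK r) r := by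
    intro r
    have := ((((du r).const_mul t).div ((du r).add_const (1 - w)) (hD r).ne')).const_add y
    refine HasDerivAt.congr_deriv this ?_
    simp only [ddK]
    have := (hD r).ne'
    field_simp
    ring
  have K0 : K 0 = 0 := by simp [K, u]
  have hK0 : ∀ r, 0 ≤ ddK r := by
    intro r
    have := hu r
    have := hD r
    have : 0 < 1 - w := by linarith
    simp only [ddK]; positivity
  have hK1 : ∀ r, ddK r ≤ t ^ 2 * (1 / 4) := by
    intro r
    simp only [ddK]
    apply mul_le_mul_of_nonneg_left _ (sq_nonneg t)
    rw [div_le_iff₀ (pow_pos (hD r) 2)]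
    nlinarith [sq_nonneg (u r - (1 - w))]
  refine ⟨fun r => if r = 0 then derK 0 else K r / r, ?_, ?_⟩
  · intro r
    unfold powerMean
    rcases eq_or_ne r 0 with h | h
    · simp only [h, if_true]
      rw [Real.rpow_def_of_pos ha, Real.rpow_def_of_pos hb, ← Real.exp_add, hx]
      congr 1
      simp [derK, u, ← hy]; ring
    · simp only [h, if_false]
      have e : w * a ^ r + (1 - w) * b ^ r = Real.exp (K r) := by
        simp only [K]
        rw [Real.exp_add, Real.exp_log (hD r), Real.rpow_def_of_pos ha, Real.rpow_def_of_pos hb, hx,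
          ← hy]
        simp only [u]
        rw [show (t + y) * r = r * t + r * y by ring, Real.exp_add, mul_comm y r]; ring
      rw [e, ← Real.exp_mul]
      congr 1; ring
  · intro r s hrs
    refine ⟨pm_slope_mono K derK ddK dK hddK hK0 K0 r s hrs, ?_⟩
    have key := pm_slope_mono (fun r => t ^ 2 / 8 * r ^ 2 - K r)
      (fun r => t ^ 2 / 8 * (2 * r) - derK r) (fun r => t ^ 2 / 8 * 2 - ddK r)
      (fun r => by
        have := ((hasDerivAt_pow 2 r).const_mul (t ^ 2 / 8)).sub (dK r)
        refine HasDerivAt.congr_deriv this ?_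
        simp)
      (fun r => by
        have := (((hasDerivAt_id r).const_mul 2).const_mul (t ^ 2 / 8)).sub (hddK r)
        refine HasDerivAt.congr_deriv this ?_
        simp)
      (fun r => by linarith [hK1 r]) (by simp [K0]) r s hrs
    have e : ∀ z : ℝ, (if z = 0 then t ^ 2 / 8 * (2 * 0) - derK 0
        else (t ^ 2 / 8 * z ^ 2 - K z) / z) = t ^ 2 / 8 * z - (if z = 0 then derK 0 else K z / z) := by
      intro z
      split_ifs with h
      · simp [h]
      · field_simp
    have key2 := (e r).symm.le.trans (key.trans (e s).le)
    linarith

/-- Multiplicative form of the sensitivity bound: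
`exp(−(Δ²/8)·|ρ₁ − ρ₂|) ≤ M_{ρ₁}(a,b)/M_{ρ₂}(a,b) ≤ exp((Δ²/8)·|ρ₁ − ρ₂|)`
with `Δ = |log(a/b)|`. -/
theorem powerMean_ratio_bounds
    (a b w : ℝ) (ha : 0 < a) (hb : 0 < b) (hw : w ∈ Set.Ioo (0 : ℝ) 1)
    (Δ : ℝ) (hΔ : Δ = |Real.log (a / b)|) :
    ∀ ρ₁ ρ₂ : ℝ,
      Real.exp (-(Δ ^ 2 / 8) * |ρ₁ - ρ₂|) ≤ powerMean w a b ρ₁ / powerMean w a b ρ₂ ∧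
      powerMean w a b ρ₁ / powerMean w a b ρ₂ ≤ Real.exp (Δ ^ 2 / 8 * |ρ₁ - ρ₂|) := by
  intro r s
  obtain ⟨L, hL, h⟩ := pm_log_bounds a b w ha hb hw
  rw [hL, hL, ← Real.exp_sub, Real.exp_le_exp, Real.exp_le_exp, hΔ, sq_abs]
  rcases le_total r s with hrs | hrs
  · obtain ⟨h1, h2⟩ := h r s hrs
    rw [abs_of_nonpos (by linarith)]
    constructor <;> nlinarith
  · obtain ⟨h1, h2⟩ := h s r hrs
    rw [abs_of_nonneg (by linarith)]
    constructor <;> nlinarith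
end

section
/- Let x₁, x₂ ∈ ℝ, w ∈ (0,1), S(ρ) = w·exp(ρx₁) + (1−w)·exp(ρx₂), and define L(ρ) = log S(ρ)/ρ for ρ ≠ 0 and L(0) = w·x₁ + (1−w)·x₂. Set Δ = |x₁ − x₂|. Then L is differentiable on all of ℝ and |L'(ρ)| ≤ Δ²/8 for every ρ ∈ ℝ. -/
/-- `S(ρ) = w·exp(ρx₁) + (1−w)·exp(ρx₂)`. -/
noncomputable def Sfun (w x₁ x₂ ρ : ℝ) : ℝ :=
  w * Real.exp (ρ * x₁) + (1 - w) * Real.exp (ρ * x₂)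

/-- `L(ρ) = log S(ρ)/ρ` for `ρ ≠ 0`, with `L(0) = w·x₁ + (1−w)·x₂`. -/
noncomputable def Lfun (w x₁ x₂ ρ : ℝ) : ℝ :=
  if ρ = 0 then w * x₁ + (1 - w) * x₂ else Real.log (Sfun w x₁ x₂ ρ) / ρ

theorem Sfun_pos_aux {w x₁ x₂ : ℝ} (hw : w ∈ Set.Ioo (0 : ℝ) 1) (ρ : ℝ) :
    0 < Sfun w x₁ x₂ ρ := by
  have h1 := hw.1
  have h2 : 0 < 1 - w := by linarith [hw.2]
  unfold Sfun
  positivity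

theorem Sfun_hasDerivAt_aux (w x₁ x₂ ρ : ℝ) :
    HasDerivAt (Sfun w x₁ x₂) (Sfun w x₁ x₂ ρ * 0 +
      (w * x₁ * Real.exp (ρ * x₁) + (1 - w) * x₂ * Real.exp (ρ * x₂))) ρ := by
  have h : ∀ x : ℝ, HasDerivAt (fun r : ℝ => Real.exp (r * x)) (Real.exp (ρ * x) * (1 * x)) ρ :=
    fun x => ((hasDerivAt_id ρ).mul_const x).exp
  have := ((h x₁).const_mul w).add ((h x₂).const_mul (1 - w))
  refine HasDerivAt.congr_deriv this ?_
  ring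

/-- derivative of `S`. -/
noncomputable def Pfun (w x₁ x₂ ρ : ℝ) : ℝ :=
  w * x₁ * Real.exp (ρ * x₁) + (1 - w) * x₂ * Real.exp (ρ * x₂)

theorem Sfun_hasDerivAt (w x₁ x₂ ρ : ℝ) :
    HasDerivAt (Sfun w x₁ x₂) (Pfun w x₁ x₂ ρ) ρ := by
  refine (Sfun_hasDerivAt_aux w x₁ x₂ ρ).congr_deriv ?_
  unfold Pfun
  ring

theorem Pfun_hasDerivAt (w x₁ x₂ ρ : ℝ) :
    HasDerivAt (Pfun w x₁ x₂)
      (w * x₁ ^ 2 * Real.exp (ρ * x₁) + (1 - w) * x₂ ^ 2 * Real.exp (ρ * x₂)) ρ := by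
  have h : ∀ x : ℝ, HasDerivAt (fun r : ℝ => Real.exp (r * x)) (Real.exp (ρ * x) * (1 * x)) ρ :=
    fun x => ((hasDerivAt_id ρ).mul_const x).exp
  have := ((h x₁).const_mul (w * x₁)).add ((h x₂).const_mul ((1 - w) * x₂))
  refine HasDerivAt.congr_deriv this ?_
  ring

/-- second derivative of `log S`. -/
noncomputable def Vfun (w x₁ x₂ ρ : ℝ) : ℝ :=
  (w * Real.exp (ρ * x₁)) * ((1 - w) * Real.exp (ρ * x₂)) * (x₁ - x₂) ^ 2 / Sfun w x₁ x₂ ρ ^ 2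

theorem logS_hasDerivAt {w x₁ x₂ : ℝ} (hw : w ∈ Set.Ioo (0 : ℝ) 1) (ρ : ℝ) :
    HasDerivAt (fun r => Real.log (Sfun w x₁ x₂ r)) (Pfun w x₁ x₂ ρ / Sfun w x₁ x₂ ρ) ρ :=
  (Sfun_hasDerivAt w x₁ x₂ ρ).log (Sfun_pos_aux hw ρ).ne'

theorem ratio_hasDerivAt {w x₁ x₂ : ℝ} (hw : w ∈ Set.Ioo (0 : ℝ) 1) (ρ : ℝ) :
    HasDerivAt (fun r => Pfun w x₁ x₂ r / Sfun w x₁ x₂ r) (Vfun w x₁ x₂ ρ) ρ := by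
  refine ((Pfun_hasDerivAt w x₁ x₂ ρ).div (Sfun_hasDerivAt w x₁ x₂ ρ)
    (Sfun_pos_aux hw ρ).ne').congr_deriv ?_
  unfold Vfun
  congr 1
  unfold Pfun Sfun
  ring

theorem Vfun_nonneg {w x₁ x₂ : ℝ} (hw : w ∈ Set.Ioo (0 : ℝ) 1) (ρ : ℝ) :
    0 ≤ Vfun w x₁ x₂ ρ := by
  have h1 := hw.1
  have h2 : 0 < 1 - w := by linarith [hw.2]
  unfold Vfun
  positivity

theorem Vfun_le {w x₁ x₂ : ℝ} (hw : w ∈ Set.Ioo (0 : ℝ) 1) (ρ : ℝ) :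
    Vfun w x₁ x₂ ρ ≤ (x₁ - x₂) ^ 2 / 4 := by
  have hS := Sfun_pos_aux (x₁ := x₁) (x₂ := x₂) hw ρ
  unfold Vfun
  rw [div_le_iff₀ (by positivity)]
  unfold Sfun
  nlinarith [mul_nonneg (sq_nonneg (w * Real.exp (ρ * x₁) - (1 - w) * Real.exp (ρ * x₂)))
    (sq_nonneg (x₁ - x₂))]

/-- numerator of `L'`. -/
noncomputable def Gfun (w x₁ x₂ ρ : ℝ) : ℝ :=
  ρ * (Pfun w x₁ x₂ ρ / Sfun w x₁ x₂ ρ) - Real.log (Sfun w x₁ x₂ ρ)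

theorem Gfun_hasDerivAt {w x₁ x₂ : ℝ} (hw : w ∈ Set.Ioo (0 : ℝ) 1) (ρ : ℝ) :
    HasDerivAt (Gfun w x₁ x₂) (ρ * Vfun w x₁ x₂ ρ) ρ := by
  refine (((hasDerivAt_id ρ).mul (ratio_hasDerivAt hw ρ)).sub
    (logS_hasDerivAt hw ρ)).congr_deriv ?_
  simp

theorem Gfun_zero (w x₁ x₂ : ℝ) : Gfun w x₁ x₂ 0 = 0 := by
  simp [Gfun, Sfun]

theorem Gfun_scaled {w x₁ x₂ : ℝ} (hw : w ∈ Set.Ioo (0 : ℝ) 1) (ρ t : ℝ) :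
    HasDerivAt (fun t => Gfun w x₁ x₂ (t * ρ)) (t * ρ ^ 2 * Vfun w x₁ x₂ (t * ρ)) t := by
  refine ((Gfun_hasDerivAt hw (t * ρ)).comp t ((hasDerivAt_id t).mul_const ρ)).congr_deriv ?_
  ring

theorem mono_aux {F F' : ℝ → ℝ} (hF : ∀ t, HasDerivAt F (F' t) t) (h : ∀ t, 0 < t → 0 ≤ F' t) :
    F 0 ≤ F 1 := by
  have : MonotoneOn F (Set.Ici 0) := by
    refine monotoneOn_of_deriv_nonneg (convex_Ici 0)
      (fun t _ => (hF t).continuousAt.continuousWithinAt)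
      (fun t _ => (hF t).differentiableAt.differentiableWithinAt) ?_
    intro t ht
    rw [interior_Ici] at ht
    rw [(hF t).deriv]
    exact h t ht
  exact this (by simp) (by simp) zero_le_one

theorem Gfun_nonneg {w x₁ x₂ : ℝ} (hw : w ∈ Set.Ioo (0 : ℝ) 1) (ρ : ℝ) :
    0 ≤ Gfun w x₁ x₂ ρ := by
  have := mono_aux (Gfun_scaled (x₁ := x₁) (x₂ := x₂) hw ρ) (fun t ht => by
    have := Vfun_nonneg (x₁ := x₁) (x₂ := x₂) hw (t * ρ)
    positivity)
  simpa [Gfun_zero] using this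

theorem Gfun_le {w x₁ x₂ : ℝ} (hw : w ∈ Set.Ioo (0 : ℝ) 1) (ρ : ℝ) :
    Gfun w x₁ x₂ ρ ≤ (x₁ - x₂) ^ 2 / 8 * ρ ^ 2 := by
  have := mono_aux (fun t => (((hasDerivAt_id t).pow 2).const_mul
    ((x₁ - x₂) ^ 2 / 8 * ρ ^ 2)).sub (Gfun_scaled (x₁ := x₁) (x₂ := x₂) hw ρ t)) (fun t ht => by
    have := Vfun_le (x₁ := x₁) (x₂ := x₂) hw (t * ρ)
    have h2 : 0 ≤ t * ρ ^ 2 := by positivity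
    have := mul_le_mul_of_nonneg_left this h2
    simp
    nlinarith)
  simpa [Gfun_zero] using this

theorem logS_analytic {w x₁ x₂ : ℝ} (hw : w ∈ Set.Ioo (0 : ℝ) 1) (ρ : ℝ) :
    AnalyticAt ℝ (fun r => Real.log (Sfun w x₁ x₂ r)) ρ := by
  refine AnalyticAt.log ?_ (Sfun_pos_aux hw ρ)
  unfold Sfun
  fun_prop

theorem Lfun_eq_dslope {w x₁ x₂ : ℝ} (hw : w ∈ Set.Ioo (0 : ℝ) 1) :
    Lfun w x₁ x₂ = dslope (fun r => Real.log (Sfun w x₁ x₂ r)) 0 := by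
  funext ρ
  by_cases h : ρ = 0
  · subst h
    rw [dslope_same, (logS_hasDerivAt hw 0).deriv]
    simp [Lfun, Pfun, Sfun]
  · rw [dslope_of_ne _ h, slope_def_field]
    simp [Lfun, h, Sfun]

theorem Lfun_analytic_zero {w x₁ x₂ : ℝ} (hw : w ∈ Set.Ioo (0 : ℝ) 1) :
    AnalyticAt ℝ (Lfun w x₁ x₂) 0 := by
  rw [Lfun_eq_dslope hw]
  obtain ⟨p, hp⟩ := logS_analytic (x₁ := x₁) (x₂ := x₂) hw 0
  exact ⟨_, hp.has_fpower_series_dslope_fslope⟩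

theorem Lfun_hasDerivAt {w x₁ x₂ : ℝ} (hw : w ∈ Set.Ioo (0 : ℝ) 1) {ρ : ℝ} (h : ρ ≠ 0) :
    HasDerivAt (Lfun w x₁ x₂) (Gfun w x₁ x₂ ρ / ρ ^ 2) ρ := by
  have h1 := (logS_hasDerivAt (x₁ := x₁) (x₂ := x₂) hw ρ).div (hasDerivAt_id ρ) h
  refine (h1.congr_of_eventuallyEq ?_).congr_deriv ?_
  · filter_upwards [isOpen_ne.mem_nhds h] with r hr
    have hr' : r ≠ 0 := hr
    simp [Lfun, hr']
  · simp [Gfun]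
    ring


/-- `L` is differentiable on all of `ℝ` and `|L'(ρ)| ≤ Δ²/8` for every `ρ`,
where `Δ = |x₁ − x₂|`. -/
theorem Lfun_differentiable_and_deriv_bound
    (x₁ x₂ w : ℝ) (hw : w ∈ Set.Ioo (0 : ℝ) 1)
    (Δ : ℝ) (hΔ : Δ = |x₁ - x₂|) :
    Differentiable ℝ (Lfun w x₁ x₂) ∧
      ∀ ρ : ℝ, |deriv (Lfun w x₁ x₂) ρ| ≤ Δ ^ 2 / 8 := by

  have hb : ∀ ρ : ℝ, ρ ≠ 0 → |deriv (Lfun w x₁ x₂) ρ| ≤ Δ ^ 2 / 8 := by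
    intro ρ h
    have hp : 0 < ρ ^ 2 := by positivity
    rw [(Lfun_hasDerivAt hw h).deriv, abs_of_nonneg (div_nonneg (Gfun_nonneg hw ρ) hp.le),
      div_le_iff₀ hp, hΔ, sq_abs]
    exact Gfun_le hw ρ
  refine ⟨fun ρ => ?_, fun ρ => ?_⟩
  · by_cases h : ρ = 0
    · subst h
      exact (Lfun_analytic_zero hw).differentiableAt
    · exact (Lfun_hasDerivAt hw h).differentiableAt
  · by_cases h : ρ = 0
    · subst h
      have hc : ContinuousAt (deriv (Lfun w x₁ x₂)) 0 := (Lfun_analytic_zero hw).deriv.continuousAt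
      have ht := (hc.abs.tendsto).mono_left (nhdsWithin_le_nhds (s := {0}ᶜ))
      refine le_of_tendsto ht ?_
      filter_upwards [self_mem_nhdsWithin] with r hr
      exact hb r hr
    · exact hb ρ h
end

section
/- Let x₁, x₂ ∈ ℝ, w ∈ (0,1), S(ρ) = w·exp(ρx₁) + (1−w)·exp(ρx₂), f(ρ) = log S(ρ), L(ρ) = f(ρ)/ρ for ρ ≠ 0, and Δ = |x₁ − x₂|. Then for every ρ ≠ 0, |L'(ρ)| = |(1/ρ²)·∫₀^ρ t·f''(t) dt| ≤ (1/ρ²)·∫₀^{|ρ|} t·(Δ²/4) dt = Δ²/8. -/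
/-- `f(ρ) = log S(ρ)`. -/
noncomputable def ffun (w x₁ x₂ ρ : ℝ) : ℝ :=
  Real.log (Sfun w x₁ x₂ ρ)

/-- The first derivative of `f`. -/
noncomputable def gfun (w x₁ x₂ ρ : ℝ) : ℝ :=
  (w * (Real.exp (ρ * x₁) * x₁) + (1 - w) * (Real.exp (ρ * x₂) * x₂)) / Sfun w x₁ x₂ ρ

/-- The second derivative of `f`. -/
noncomputable def hfun (w x₁ x₂ ρ : ℝ) : ℝ :=
  (w * Real.exp (ρ * x₁)) * ((1 - w) * Real.exp (ρ * x₂)) * (x₁ - x₂) ^ 2 / Sfun w x₁ x₂ ρ ^ 2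

lemma Sfun_pos {w : ℝ} (hw : w ∈ Set.Ioo (0 : ℝ) 1) (x₁ x₂ ρ : ℝ) : 0 < Sfun w x₁ x₂ ρ := by
  have h1 := hw.1
  have h2 : 0 < 1 - w := by linarith [hw.2]
  unfold Sfun
  positivity

lemma hasDerivAt_exp_mul (x t : ℝ) :
    HasDerivAt (fun t : ℝ => Real.exp (t * x)) (Real.exp (t * x) * x) t := by
  simpa using ((hasDerivAt_id t).mul_const x).exp

lemma hasDerivAt_Sfun (w x₁ x₂ t : ℝ) : HasDerivAt (Sfun w x₁ x₂)
    (w * (Real.exp (t * x₁) * x₁) + (1 - w) * (Real.exp (t * x₂) * x₂)) t :=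
  ((hasDerivAt_exp_mul x₁ t).const_mul w).add ((hasDerivAt_exp_mul x₂ t).const_mul (1 - w))

lemma hasDerivAt_ffun {w : ℝ} (hw : w ∈ Set.Ioo (0 : ℝ) 1) (x₁ x₂ t : ℝ) :
    HasDerivAt (ffun w x₁ x₂) (gfun w x₁ x₂ t) t :=
  (hasDerivAt_Sfun w x₁ x₂ t).log (Sfun_pos hw x₁ x₂ t).ne'

lemma hasDerivAt_gfun {w : ℝ} (hw : w ∈ Set.Ioo (0 : ℝ) 1) (x₁ x₂ t : ℝ) :
    HasDerivAt (gfun w x₁ x₂) (hfun w x₁ x₂ t) t := by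
  have h := ((((hasDerivAt_exp_mul x₁ t).mul_const x₁).const_mul w).add
    (((hasDerivAt_exp_mul x₂ t).mul_const x₂).const_mul (1 - w))).div
    (hasDerivAt_Sfun w x₁ x₂ t) (Sfun_pos hw x₁ x₂ t).ne'
  refine h.congr_deriv ?_
  unfold hfun
  congr 1
  simp only [Sfun, Pi.add_apply]
  ring

lemma hfun_nonneg {w : ℝ} (hw : w ∈ Set.Ioo (0 : ℝ) 1) (x₁ x₂ t : ℝ) :
    0 ≤ hfun w x₁ x₂ t := by
  have h1 := hw.1
  have h2 : 0 < 1 - w := by linarith [hw.2]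
  unfold hfun
  positivity

lemma hfun_le {w : ℝ} (hw : w ∈ Set.Ioo (0 : ℝ) 1) (x₁ x₂ t : ℝ) :
    hfun w x₁ x₂ t ≤ (x₁ - x₂) ^ 2 / 4 := by
  have hS := Sfun_pos hw x₁ x₂ t
  unfold hfun
  rw [div_le_iff₀ (by positivity)]
  unfold Sfun
  nlinarith [mul_nonneg (sq_nonneg (w * Real.exp (t * x₁) - (1 - w) * Real.exp (t * x₂)))
    (sq_nonneg (x₁ - x₂))]

lemma continuous_hfun {w : ℝ} (hw : w ∈ Set.Ioo (0 : ℝ) 1) (x₁ x₂ : ℝ) :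
    Continuous (hfun w x₁ x₂) := by
  have hS : Continuous (Sfun w x₁ x₂) := by
    unfold Sfun
    fun_prop
  unfold hfun
  refine Continuous.div (by fun_prop) (by fun_prop) fun t => ?_
  exact pow_ne_zero _ (Sfun_pos hw x₁ x₂ t).ne'

lemma integral_mul_hfun {w : ℝ} (hw : w ∈ Set.Ioo (0 : ℝ) 1) (x₁ x₂ ρ : ℝ) :
    ∫ t in (0 : ℝ)..ρ, t * hfun w x₁ x₂ t = ρ * gfun w x₁ x₂ ρ - ffun w x₁ x₂ ρ := by
  have hd : ∀ t ∈ Set.uIcc 0 ρ, HasDerivAt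
      (fun t => t * gfun w x₁ x₂ t - ffun w x₁ x₂ t) (t * hfun w x₁ x₂ t) t := by
    intro t _
    refine (((hasDerivAt_id t).mul (hasDerivAt_gfun hw x₁ x₂ t)).sub
      (hasDerivAt_ffun hw x₁ x₂ t)).congr_deriv ?_
    simp
  rw [intervalIntegral.integral_eq_sub_of_hasDerivAt hd
    ((continuous_id.mul (continuous_hfun hw x₁ x₂)).intervalIntegrable _ _)]
  simp [ffun, Sfun]

/-- For every `ρ ≠ 0`, with `L(ρ) = f(ρ)/ρ` and `Δ = |x₁ − x₂|`:
`|L'(ρ)| = |(1/ρ²)·∫₀^ρ t·f''(t) dt| ≤ (1/ρ²)·∫₀^{|ρ|} t·(Δ²/4) dt = Δ²/8`. -/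
theorem abs_deriv_L_le_delta_sq_div_eight
    (x₁ x₂ w : ℝ) (hw : w ∈ Set.Ioo (0 : ℝ) 1)
    (Δ : ℝ) (hΔ : Δ = |x₁ - x₂|) :
    ∀ ρ : ℝ, ρ ≠ 0 →
      |deriv (fun σ => ffun w x₁ x₂ σ / σ) ρ| =
        |(1 / ρ ^ 2) * ∫ t in (0 : ℝ)..ρ, t * deriv (deriv (ffun w x₁ x₂)) t| ∧
      |(1 / ρ ^ 2) * ∫ t in (0 : ℝ)..ρ, t * deriv (deriv (ffun w x₁ x₂)) t| ≤
        (1 / ρ ^ 2) * ∫ t in (0 : ℝ)..|ρ|, t * (Δ ^ 2 / 4) ∧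
      (1 / ρ ^ 2) * (∫ t in (0 : ℝ)..|ρ|, t * (Δ ^ 2 / 4)) = Δ ^ 2 / 8 := by
  have hf : deriv (ffun w x₁ x₂) = gfun w x₁ x₂ :=
    funext fun t => (hasDerivAt_ffun hw x₁ x₂ t).deriv
  have hg : deriv (gfun w x₁ x₂) = hfun w x₁ x₂ :=
    funext fun t => (hasDerivAt_gfun hw x₁ x₂ t).deriv
  have hD : Δ ^ 2 = (x₁ - x₂) ^ 2 := by rw [hΔ, sq_abs]
  intro ρ hρ
  rw [hf, hg, hD]
  refine ⟨?_, ?_, ?_⟩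
  · have hL : deriv (fun σ => ffun w x₁ x₂ σ / σ) ρ =
        (gfun w x₁ x₂ ρ * id ρ - ffun w x₁ x₂ ρ * 1) / id ρ ^ 2 :=
      ((hasDerivAt_ffun hw x₁ x₂ ρ).div (hasDerivAt_id ρ) hρ).deriv
    rw [integral_mul_hfun hw, hL]
    congr 1
    simp only [id]
    field_simp
  · rw [abs_mul, abs_of_nonneg (show 0 ≤ 1 / ρ ^ 2 by positivity)]
    refine mul_le_mul_of_nonneg_left ?_ (by positivity)
    have key : ∀ t, |t * hfun w x₁ x₂ t| ≤ |t| * ((x₁ - x₂) ^ 2 / 4) := fun t => by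
      rw [abs_mul, abs_of_nonneg (hfun_nonneg hw x₁ x₂ t)]
      exact mul_le_mul_of_nonneg_left (hfun_le hw x₁ x₂ t) (abs_nonneg t)
    rcases lt_or_gt_of_ne hρ with h | h
    · rw [abs_of_neg h, intervalIntegral.integral_symm, abs_neg, ← Real.norm_eq_abs]
      have := intervalIntegral.norm_integral_le_of_norm_le (μ := MeasureTheory.volume)
        (f := fun t => t * hfun w x₁ x₂ t)
        (g := fun t => -t * ((x₁ - x₂) ^ 2 / 4)) h.le
        (Filter.Eventually.of_forall fun t ht => by
          have := key t
          rwa [abs_of_nonpos ht.2] at this)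
        (Continuous.intervalIntegrable (by fun_prop) _ _)
      refine this.trans (le_of_eq ?_)
      have hn : ∫ t in ρ..0, -t = -∫ t in ρ..0, t := intervalIntegral.integral_neg
      rw [intervalIntegral.integral_mul_const, intervalIntegral.integral_mul_const, hn,
        integral_id, integral_id]
      ring
    · rw [abs_of_pos h, ← Real.norm_eq_abs]
      exact intervalIntegral.norm_integral_le_of_norm_le h.le
        (Filter.Eventually.of_forall fun t ht => by
          have := key t
          rwa [abs_of_pos ht.1] at this)
        (Continuous.intervalIntegrable (by fun_prop) _ _)
  · rw [intervalIntegral.integral_mul_const, integral_id, sq_abs]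
    field_simp
    ring
end

section
/- Let Δ > 0, w = 1/2, x₁ = Δ/2, x₂ = −Δ/2, S(ρ) = (1/2)·exp(ρΔ/2) + (1/2)·exp(−ρΔ/2), and L(ρ) = log S(ρ)/ρ for ρ ≠ 0 with L(0) = 0. Then L'(0) = Δ²/8. Hence the Lipschitz constant Δ²/8 in the bound |L(ρ₁) − L(ρ₂)| ≤ (Δ²/8)·|ρ₁ − ρ₂| cannot be improved in general. -/
/-- The tightness witness: with `w = 1/2`, `x₁ = Δ/2`, `x₂ = −Δ/2`,
`L(ρ) = log((1/2)·exp(ρΔ/2) + (1/2)·exp(−ρΔ/2))/ρ` for `ρ ≠ 0` and `L(0) = 0`. -/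
noncomputable def Ltight (Δ ρ : ℝ) : ℝ :=
  if ρ = 0 then 0
  else Real.log ((1 / 2) * Real.exp (ρ * Δ / 2) + (1 / 2) * Real.exp (-(ρ * Δ / 2))) / ρ

/-- For `Δ > 0`, the symmetric witness attains `L'(0) = Δ²/8`, so the Lipschitz
constant `Δ²/8` cannot be improved in general. -/
theorem deriv_Ltight_at_zero (Δ : ℝ) (hΔ : 0 < Δ) :
    HasDerivAt (Ltight Δ) (Δ ^ 2 / 8) 0 := by
  have key : ∀ ρ : ℝ, ρ ≠ 0 → slope (Ltight Δ) 0 ρ = Real.log (Real.cosh (ρ * Δ / 2)) / ρ ^ 2 := by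
    intro ρ hρ
    have hc : (1 / 2) * Real.exp (ρ * Δ / 2) + (1 / 2) * Real.exp (-(ρ * Δ / 2))
        = Real.cosh (ρ * Δ / 2) := by
      rw [Real.cosh_eq]; ring
    rw [slope_def_field]
    simp only [Ltight, hρ, if_true, if_false, hc, sub_zero]
    field_simp
  rw [hasDerivAt_iff_tendsto_slope]
  have hlow : Filter.Tendsto (fun ρ : ℝ => (Δ ^ 2 / 8) / (1 + ρ ^ 2 * Δ ^ 2 / 8))
      (nhdsWithin 0 {0}ᶜ) (nhds (Δ ^ 2 / 8)) := by
    have : ContinuousAt (fun ρ : ℝ => (Δ ^ 2 / 8) / (1 + ρ ^ 2 * Δ ^ 2 / 8)) 0 := by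
      apply ContinuousAt.div
      · fun_prop
      · fun_prop
      · simp
    have h2 := this.tendsto
    simp only [ne_eq, OfNat.ofNat_ne_zero, not_false_eq_true, zero_pow, zero_mul, zero_div,
      add_zero, div_one] at h2
    exact h2.mono_left nhdsWithin_le_nhds
  refine tendsto_of_tendsto_of_tendsto_of_le_of_le' hlow tendsto_const_nhds ?_ ?_
  · filter_upwards [self_mem_nhdsWithin] with ρ hρ
    have hρ : ρ ≠ 0 := hρ
    rw [key ρ hρ]
    have hp : 0 < ρ ^ 2 := by positivity
    set x := ρ * Δ / 2 with hx
    have hcosh : 1 + x ^ 2 / 2 ≤ Real.cosh x := by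
      have h1 : Real.cosh x = 1 + 2 * Real.sinh (x / 2) ^ 2 := by
        have h := Real.cosh_two_mul (x / 2)
        rw [Real.cosh_sq, show 2 * (x / 2) = x by ring] at h
        linarith
      have h2 : (x / 2) ^ 2 ≤ Real.sinh (x / 2) ^ 2 := by
        rw [← sq_abs (x / 2), ← sq_abs (Real.sinh (x / 2)), Real.abs_sinh]
        have := Real.self_le_sinh_iff.2 (abs_nonneg (x / 2))
        gcongr
      linarith
    have hpos : 0 < 1 + x ^ 2 / 2 := by positivity
    have h3 := Real.one_sub_inv_le_log_of_pos hpos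
    have h4 := Real.log_le_log hpos hcosh
    rw [le_div_iff₀ hp]
    refine le_trans (le_of_eq ?_) (h3.trans h4)
    rw [hx] at hpos ⊢
    have e : (ρ * Δ / 2) ^ 2 / 2 = ρ ^ 2 * Δ ^ 2 / 8 := by ring
    rw [e] at hpos ⊢
    have := hpos.ne'
    field_simp
    ring
  · filter_upwards [self_mem_nhdsWithin] with ρ hρ
    have hρ : ρ ≠ 0 := hρ
    rw [key ρ hρ]
    have hp : 0 < ρ ^ 2 := by positivity
    rw [div_le_iff₀ hp, Real.log_le_iff_le_exp (Real.cosh_pos _)]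
    refine (Real.cosh_le_exp_half_sq _).trans (le_of_eq ?_)
    congr 1
    ring
end
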